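/- arXiv:2005.02822 — 2 statements merged into one kernel-verified Lean document; each statement's English description precedes it below -/
import Mathlib

section
/- Define u₀ := 1, u_k := ( (2k+1)(2k+3)⋯(6k−1) ) / ( 216^k · k! ) for k ≥ 1 (the product of 2k consecutive odd numbers from 2k+1 to 6k−1), ν₀ := 1, and ν_k := ((6k+1)/(1−6k))·u_k for k ≥ 1. For an integer N ≥ 0 and ζ ∈ ℂ ∖ (−∞,0], define the 2×2 complex matrices (all complex powers taken with the principal branch): m_N(ζ) := (e^{iπ/12}/(2√π)) ∑_{k=0}^{N} ((2/3)ζ^{3/2})^{−k} · diag(ζ^{−1/4}, ζ^{1/4}) · [[(−1)^k u_k, u_k], [−(−1)^k ν_k, ν_k]] · diag(e^{−iπ/4}, e^{iπ/4}) and m_N^{inv}(ζ) := √π e^{−iπ/12} ∑_{k=0}^{N} ((2/3)ζ^{3/2})^{−k} · diag(e^{iπ/4}, e^{−iπ/4}) · [[ν_k, −u_k], [(−1)^k ν_k, (−1)^k u_k]] · diag(ζ^{1/4}, ζ^{−1/4}). Then m_N and m_N^{inv} are analytic on ℂ ∖ (−∞,0], and for every x < 0 the limits m_{N,±}(x) :=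 lim_{ε→0⁺} m_N(x ± iε) and m^{inv}_{N,±}(x) := lim_{ε→0⁺} m_N^{inv}(x ± iε) exist and satisfy m_{N,+}(x) = m_{N,−}(x) · [[0,1],[−1,0]] and m^{inv}_{N,+}(x) = [[0,−1],[1,0]] · m^{inv}_{N,−}(x). -/
open Set Complex Topology Matrix

/-- Upper boundary value of a principal power on the negative real axis. -/
theorem tendsto_cpow_add_mul_I {x : ℝ} (hx : x < 0) (a : ℂ) :
    Filter.Tendsto (fun ε : ℝ => ((x : ℂ) + (ε : ℂ) * I) ^ a) (𝓝[>] 0)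
      (𝓝 (exp ((Real.log ‖(x : ℂ)‖ + Real.pi * I) * a))) := by
  have hpath : Filter.Tendsto (fun ε : ℝ => (x : ℂ) + (ε : ℂ) * I) (𝓝[>] 0)
      (𝓝[{z : ℂ | 0 ≤ z.im}] (x : ℂ)) := by
    refine tendsto_nhdsWithin_iff.2 ⟨?_, ?_⟩
    · have h : Continuous fun ε : ℝ => (x : ℂ) + (ε : ℂ) * I := by fun_prop
      simpa using (h.tendsto 0).mono_left nhdsWithin_le_nhds
    · filter_upwards [self_mem_nhdsWithin] with ε hε
      simpa using (mem_Ioi.1 hε).le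
  have hlog := (tendsto_log_nhdsWithin_im_nonneg_of_re_neg_of_im_zero
    (z := (x : ℂ)) (by simpa using hx) (by simp)).comp hpath
  refine ((continuous_exp.tendsto _).comp (hlog.mul_const a)).congr fun ε => ?_
  have hne : (x : ℂ) + (ε : ℂ) * I ≠ 0 := fun h => hx.ne (by simpa using congrArg re h)
  simp [cpow_def_of_ne_zero hne]

/-- Lower boundary value of a principal power on the negative real axis. -/
theorem tendsto_cpow_sub_mul_I {x : ℝ} (hx : x < 0) (a : ℂ) :
    Filter.Tendsto (fun ε : ℝ => ((x : ℂ) - (ε : ℂ) * I) ^ a) (𝓝[>] 0)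
      (𝓝 (exp ((Real.log ‖(x : ℂ)‖ - Real.pi * I) * a))) := by
  have hpath : Filter.Tendsto (fun ε : ℝ => (x : ℂ) - (ε : ℂ) * I) (𝓝[>] 0)
      (𝓝[{z : ℂ | z.im < 0}] (x : ℂ)) := by
    refine tendsto_nhdsWithin_iff.2 ⟨?_, ?_⟩
    · have h : Continuous fun ε : ℝ => (x : ℂ) - (ε : ℂ) * I := by fun_prop
      simpa using (h.tendsto 0).mono_left nhdsWithin_le_nhds
    · filter_upwards [self_mem_nhdsWithin] with ε hε
      simpa using mem_Ioi.1 hε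
  have hlog := (tendsto_log_nhdsWithin_im_neg_of_re_neg_of_im_zero
    (z := (x : ℂ)) (by simpa using hx) (by simp)).comp hpath
  refine ((continuous_exp.tendsto _).comp (hlog.mul_const a)).congr fun ε => ?_
  have hne : (x : ℂ) - (ε : ℂ) * I ≠ 0 := fun h => hx.ne (by simpa using congrArg re h)
  simp [cpow_def_of_ne_zero hne]

/-- The two boundary values of a principal power differ by the factor `exp (2πia)`. -/
theorem exp_add_pi_mul_I_mul (l a : ℂ) :
    exp ((l + Real.pi * I) * a) = exp (2 * Real.pi * I * a) * exp ((l - Real.pi * I) * a) := by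
  rw [← exp_add]
  congr 1
  ring

theorem exp_two_pi_mul_I_mul_quarter : exp (2 * Real.pi * I * (1 / 4)) = I := by
  refine (congrArg exp ?_).trans exp_pi_div_two_mul_I
  ring

theorem exp_two_pi_mul_I_mul_neg_quarter : exp (2 * Real.pi * I * (-1 / 4)) = -I := by
  refine (congrArg exp ?_).trans exp_neg_pi_div_two_mul_I
  ring

theorem exp_two_pi_mul_I_mul_three_halves : exp (2 * Real.pi * I * (3 / 2)) = -1 := by
  rw [← exp_pi_mul_I, ← exp_periodic (Real.pi * I)]
  congr 1
  ring

theorem exp_neg_I_mul_pi_div_four :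
    exp (-I * Real.pi / 4) = -I * exp (I * Real.pi / 4) := by
  have h : -I * Real.pi / 4 = -Real.pi / 2 * I + I * Real.pi / 4 := by ring
  rw [h, exp_add, exp_neg_pi_div_two_mul_I]

/-- A finite expansion in powers of `w` whose coefficients are matrices scaled on the left by
`diag(p, q)`. -/
noncomputable def leftExpansion (N : ℕ) (C : ℂ) (A : ℕ → Matrix (Fin 2) (Fin 2) ℂ)
    (D : Matrix (Fin 2) (Fin 2) ℂ) (p q w : ℂ) : Matrix (Fin 2) (Fin 2) ℂ :=
  C • ∑ k ∈ Finset.range (N + 1), (w ^ k) • (!![p, 0; 0, q] * A k * D)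

/-- A finite expansion in powers of `w` whose coefficients are matrices scaled on the right by
`diag(q, p)`. -/
noncomputable def rightExpansion (N : ℕ) (C : ℂ) (A : ℕ → Matrix (Fin 2) (Fin 2) ℂ)
    (D : Matrix (Fin 2) (Fin 2) ℂ) (p q w : ℂ) : Matrix (Fin 2) (Fin 2) ℂ :=
  C • ∑ k ∈ Finset.range (N + 1), (w ^ k) • (D * A k * !![q, 0; 0, p])

section Expansions

variable (N : ℕ) (C : ℂ) (A : ℕ → Matrix (Fin 2) (Fin 2) ℂ) (D : Matrix (Fin 2) (Fin 2) ℂ)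

theorem continuous_leftExpansion :
    Continuous fun y : ℂ × ℂ × ℂ => leftExpansion N C A D y.1 y.2.1 y.2.2 := by
  unfold leftExpansion
  refine (continuous_finsetSum _ fun k _ => ?_).const_smul C
  refine Continuous.smul (f := fun y : ℂ × ℂ × ℂ => y.2.2 ^ k) (by fun_prop) ?_
  refine ((continuous_matrix fun i j => ?_).matrix_mul continuous_const).matrix_mul
    continuous_const
  fin_cases i <;> fin_cases j <;> simp <;> fun_prop

theorem tendsto_leftExpansion {α : Type*} {l : Filter α} {p q w : α → ℂ} {p₀ q₀ w₀ : ℂ}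
    (hp : Filter.Tendsto p l (𝓝 p₀)) (hq : Filter.Tendsto q l (𝓝 q₀))
    (hw : Filter.Tendsto w l (𝓝 w₀)) :
    Filter.Tendsto (fun a => leftExpansion N C A D (p a) (q a) (w a)) l
      (𝓝 (leftExpansion N C A D p₀ q₀ w₀)) := by
  have hpair := hp.prodMk_nhds (hq.prodMk_nhds hw)
  have h := ((continuous_leftExpansion N C A D).tendsto (p₀, q₀, w₀)).comp hpair
  simpa only [Function.comp_def] using h

theorem continuous_rightExpansion :
    Continuous fun y : ℂ × ℂ × ℂ => rightExpansion N C A D y.1 y.2.1 y.2.2 := by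
  unfold rightExpansion
  refine (continuous_finsetSum _ fun k _ => ?_).const_smul C
  refine Continuous.smul (f := fun y : ℂ × ℂ × ℂ => y.2.2 ^ k) (by fun_prop) ?_
  refine continuous_const.matrix_mul (continuous_matrix fun i j => ?_)
  fin_cases i <;> fin_cases j <;> simp <;> fun_prop

theorem tendsto_rightExpansion {α : Type*} {l : Filter α} {p q w : α → ℂ} {p₀ q₀ w₀ : ℂ}
    (hp : Filter.Tendsto p l (𝓝 p₀)) (hq : Filter.Tendsto q l (𝓝 q₀))
    (hw : Filter.Tendsto w l (𝓝 w₀)) :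
    Filter.Tendsto (fun a => rightExpansion N C A D (p a) (q a) (w a)) l
      (𝓝 (rightExpansion N C A D p₀ q₀ w₀)) := by
  have hpair := hp.prodMk_nhds (hq.prodMk_nhds hw)
  have h := ((continuous_rightExpansion N C A D).tendsto (p₀, q₀, w₀)).comp hpair
  simpa only [Function.comp_def] using h

theorem AnalyticAt.leftExpansion_apply {p q w : ℂ → ℂ} {z : ℂ} (hp : AnalyticAt ℂ p z)
    (hq : AnalyticAt ℂ q z) (hw : AnalyticAt ℂ w z) (i j : Fin 2) :
    AnalyticAt ℂ (fun ζ => leftExpansion N C A D (p ζ) (q ζ) (w ζ) i j) z := by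
  simp only [leftExpansion, Matrix.smul_apply, Matrix.sum_apply, smul_eq_mul]
  refine analyticAt_const.mul (Finset.analyticAt_fun_sum _ fun k _ => (hw.fun_pow k).mul ?_)
  fin_cases i <;> fin_cases j <;>
    simp only [Matrix.mul_apply, Fin.sum_univ_two] <;> simp <;> fun_prop

theorem AnalyticAt.rightExpansion_apply {p q w : ℂ → ℂ} {z : ℂ} (hp : AnalyticAt ℂ p z)
    (hq : AnalyticAt ℂ q z) (hw : AnalyticAt ℂ w z) (i j : Fin 2) :
    AnalyticAt ℂ (fun ζ => rightExpansion N C A D (p ζ) (q ζ) (w ζ) i j) z := by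
  simp only [rightExpansion, Matrix.smul_apply, Matrix.sum_apply, smul_eq_mul]
  refine analyticAt_const.mul (Finset.analyticAt_fun_sum _ fun k _ => (hw.fun_pow k).mul ?_)
  fin_cases i <;> fin_cases j <;>
    simp only [Matrix.mul_apply, Fin.sum_univ_two] <;> simp <;> fun_prop

theorem leftExpansion_jump (a b : ℕ → ℂ) (e p q w : ℂ) :
    leftExpansion N C (fun k => !![(-1) ^ k * a k, a k; -(-1) ^ k * b k, b k])
        !![-I * e, 0; 0, e] (-I * p) (I * q) (-w) =
      leftExpansion N C (fun k => !![(-1) ^ k * a k, a k; -(-1) ^ k * b k, b k])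
        !![-I * e, 0; 0, e] p q w * !![0, 1; -1, 0] := by
  simp only [leftExpansion, Matrix.smul_mul, Finset.sum_mul]
  congr 1
  refine Finset.sum_congr rfl fun k _ => ?_
  ext i j
  rcases Nat.even_or_odd k with h | h <;> fin_cases i <;> fin_cases j <;>
    simp [h.neg_pow] <;> ring_nf <;> simp

theorem rightExpansion_jump (a b : ℕ → ℂ) (e p q w : ℂ) :
    rightExpansion N C (fun k => !![b k, -a k; (-1) ^ k * b k, (-1) ^ k * a k])
        !![e, 0; 0, -I * e] (-I * p) (I * q) (-w) =
      !![0, -1; 1, 0] *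
        rightExpansion N C (fun k => !![b k, -a k; (-1) ^ k * b k, (-1) ^ k * a k])
          !![e, 0; 0, -I * e] p q w := by
  simp only [rightExpansion, Matrix.mul_smul, Finset.mul_sum]
  congr 1
  refine Finset.sum_congr rfl fun k _ => ?_
  ext i j
  rcases Nat.even_or_odd k with h | h <;> fin_cases i <;> fin_cases j <;>
    simp [h.neg_pow] <;> ring_nf <;> simp

end Expansions

/-- The truncated asymptotic approximants `m_N`, `m_N^{inv}` of the Airy model solution
and its inverse are analytic off `(-∞,0]` and satisfy the stated jump relations across
the negative real axis. -/
theorem stmt12 (u v : ℕ → ℝ)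
    (hu0 : u 0 = 1)
    (hu : ∀ k : ℕ, 1 ≤ k →
      u k = (∏ j ∈ Finset.range (2 * k), (2 * k + 1 + 2 * j : ℝ)) /
        (216 ^ k * Nat.factorial k))
    (hv0 : v 0 = 1)
    (hv : ∀ k : ℕ, 1 ≤ k → v k = ((6 * k + 1 : ℝ) / (1 - 6 * k)) * u k)
    (N : ℕ)
    (m minv : ℂ → Matrix (Fin 2) (Fin 2) ℂ)
    (hm : ∀ ζ : ℂ, m ζ =
      (Complex.exp (Complex.I * (Real.pi : ℂ) / 12) /
          (2 * ((Real.sqrt Real.pi : ℝ) : ℂ))) •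
        ∑ k ∈ Finset.range (N + 1),
          ((((2 : ℂ) / 3) * ζ ^ ((3 : ℂ) / 2))⁻¹ ^ k) •
            (!![ζ ^ (-(1 : ℂ) / 4), 0; 0, ζ ^ ((1 : ℂ) / 4)] *
             !![(-1 : ℂ) ^ k * (u k : ℂ), (u k : ℂ);
                -(-1 : ℂ) ^ k * (v k : ℂ), (v k : ℂ)] *
             !![Complex.exp (-Complex.I * (Real.pi : ℂ) / 4), 0;
                0, Complex.exp (Complex.I * (Real.pi : ℂ) / 4)]))
    (hminv : ∀ ζ : ℂ, minv ζ =
      (((Real.sqrt Real.pi : ℝ) : ℂ) *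
          Complex.exp (-Complex.I * (Real.pi : ℂ) / 12)) •
        ∑ k ∈ Finset.range (N + 1),
          ((((2 : ℂ) / 3) * ζ ^ ((3 : ℂ) / 2))⁻¹ ^ k) •
            (!![Complex.exp (Complex.I * (Real.pi : ℂ) / 4), 0;
                0, Complex.exp (-Complex.I * (Real.pi : ℂ) / 4)] *
             !![(v k : ℂ), -(u k : ℂ);
                (-1 : ℂ) ^ k * (v k : ℂ), (-1 : ℂ) ^ k * (u k : ℂ)] *
             !![ζ ^ ((1 : ℂ) / 4), 0; 0, ζ ^ (-(1 : ℂ) / 4)])) :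
    (∀ i j : Fin 2,
      AnalyticOnNhd ℂ (fun ζ => m ζ i j) {ζ : ℂ | ¬(ζ.im = 0 ∧ ζ.re ≤ 0)} ∧
      AnalyticOnNhd ℂ (fun ζ => minv ζ i j) {ζ : ℂ | ¬(ζ.im = 0 ∧ ζ.re ≤ 0)}) ∧
    ∀ x : ℝ, x < 0 →
      ∃ Mp Mm Mpi Mmi : Matrix (Fin 2) (Fin 2) ℂ,
        Filter.Tendsto (fun ε : ℝ => m ((x : ℂ) + (ε : ℂ) * Complex.I))
          (𝓝[>] 0) (𝓝 Mp) ∧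
        Filter.Tendsto (fun ε : ℝ => m ((x : ℂ) - (ε : ℂ) * Complex.I))
          (𝓝[>] 0) (𝓝 Mm) ∧
        Filter.Tendsto (fun ε : ℝ => minv ((x : ℂ) + (ε : ℂ) * Complex.I))
          (𝓝[>] 0) (𝓝 Mpi) ∧
        Filter.Tendsto (fun ε : ℝ => minv ((x : ℂ) - (ε : ℂ) * Complex.I))
          (𝓝[>] 0) (𝓝 Mmi) ∧
        Mp = Mm * !![(0 : ℂ), 1; -1, 0] ∧
        Mpi = !![(0 : ℂ), -1; 1, 0] * Mmi := by
  set e := exp (I * (Real.pi : ℂ) / 4) with he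
  have hm' : m = fun ζ => leftExpansion N _ _ _ _ _ _ := funext hm
  have hminv' : minv = fun ζ => rightExpansion N _ _ _ _ _ _ := funext hminv
  rw [exp_neg_I_mul_pi_div_four, ← he] at hm' hminv'
  refine ⟨fun i j => ⟨fun z hz => ?_, fun z hz => ?_⟩, fun x hx => ?_⟩
  iterate 2
    have hz' : z ∈ slitPlane := by
      by_contra h
      exact hz (by simpa [mem_slitPlane_iff, and_comm] using h)
    have hpow (a : ℂ) : AnalyticAt ℂ (fun ζ : ℂ => ζ ^ a) z :=
      analyticAt_id.cpow analyticAt_const hz'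
    have hw : AnalyticAt ℂ (fun ζ : ℂ => ((2 : ℂ) / 3 * ζ ^ ((3 : ℂ) / 2))⁻¹) z :=
      (analyticAt_const.mul (hpow _)).fun_inv (by simp [cpow_eq_zero_iff, slitPlane_ne_zero hz'])
    first
    | rw [hm']
      exact (hpow _).leftExpansion_apply _ _ _ _ (hpow _) hw i j
    | rw [hminv']
      exact (hpow _).rightExpansion_apply _ _ _ _ (hpow _) hw i j
  have hp := tendsto_cpow_add_mul_I hx
  have hn := tendsto_cpow_sub_mul_I hx
  have hwp := ((hp (3 / 2)).const_mul (2 / 3)).inv₀ (by simp)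
  have hwn := ((hn (3 / 2)).const_mul (2 / 3)).inv₀ (by simp)
  rw [hm', hminv']
  refine ⟨_, _, _, _, tendsto_leftExpansion _ _ _ _ (hp _) (hp _) hwp,
    tendsto_leftExpansion _ _ _ _ (hn _) (hn _) hwn,
    tendsto_rightExpansion _ _ _ _ (hp _) (hp _) hwp,
    tendsto_rightExpansion _ _ _ _ (hn _) (hn _) hwn, ?_, ?_⟩
  all_goals
    rw [exp_add_pi_mul_I_mul, exp_add_pi_mul_I_mul _ (1 / 4), exp_add_pi_mul_I_mul _ (3 / 2),
      exp_two_pi_mul_I_mul_quarter, exp_two_pi_mul_I_mul_neg_quarter,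
      exp_two_pi_mul_I_mul_three_halves, neg_one_mul, mul_neg, inv_neg]
  · exact leftExpansion_jump ..
  · exact rightExpansion_jump ..
end

section
/- For every t₀ ∈ (0,1), setting p := γ(t₀), the one-sided limits δ̃₊(p) := lim_{ε→0⁺} δ̃(p + i ε γ'(t₀)) (from the left of Γ) and δ̃₋(p) := lim_{ε→0⁺} δ̃(p − i ε γ'(t₀)) (from the right of Γ) exist, are nonzero, and satisfy the jump relation δ̃₊(p) = δ̃₋(p) · e^{−φ(t₀)}. -/
open Set Complex Topology ComplexConjugate
open scoped Interval

/-- Dominated convergence for Cauchy-type integrals whose density vanishes linearly at `t₀`. -/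
lemma tendsto_cauchy_integral_of_density_le {w w' F : ℝ → ℂ} {κ : ℝ → ℂ} {t₀ α β c C : ℝ}
    (hα : 0 ≤ α) (hαβ : α ≤ β) (hβ : β ≤ 1) (hc : 0 < c)
    (hwc : ContinuousOn w (Icc 0 1)) (hw'c : ContinuousOn w' (Icc 0 1))
    (hFc : ContinuousOn F (Icc 0 1))
    (hF : ∀ t ∈ Icc α β, ‖F t‖ ≤ C * |t - t₀|)
    (hw : ∀ t ∈ Icc (0 : ℝ) 1, c * |t - t₀| ≤ ‖w t‖)
    (hκ : Filter.Tendsto κ (𝓝[>] 0) (𝓝 0))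
    (hwκ : ∀ᶠ ε in 𝓝[>] (0 : ℝ), ∀ t ∈ Icc (0 : ℝ) 1,
      w t - κ ε ≠ 0 ∧ c * |t - t₀| ≤ ‖w t - κ ε‖) :
    Filter.Tendsto (fun ε => ∫ t in α..β, F t * w' t / (w t - κ ε)) (𝓝[>] 0)
      (𝓝 (∫ t in α..β, F t * w' t / w t)) := by
  obtain ⟨M, hM⟩ := isCompact_Icc.exists_bound_of_continuousOn hw'c
  have hsub : Icc α β ⊆ Icc 0 1 := Icc_subset_Icc hα hβ
  have hioc : Ι α β ⊆ Icc α β := by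
    rw [uIoc_of_le hαβ]; exact Ioc_subset_Icc_self
  refine intervalIntegral.tendsto_integral_filter_of_dominated_convergence
    (fun _ => C * M / c) ?_ ?_ (by simp) ?_
  · filter_upwards [hwκ] with ε hε
    have h : ContinuousOn (fun t => F t * w' t / (w t - κ ε)) (Icc 0 1) :=
      (hFc.mul hw'c).div (hwc.sub continuousOn_const) fun t ht => (hε t ht).1
    exact (h.mono (hioc.trans hsub)).aestronglyMeasurable measurableSet_uIoc
  · filter_upwards [hwκ] with ε hε
    refine Filter.Eventually.of_forall fun t ht => ?_
    have ht' := hioc ht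
    obtain ⟨h1, h2⟩ := hε t (hsub ht')
    have h3 := hF t ht'
    have h4 := hM t (hsub ht')
    have h5 : 0 < ‖w t - κ ε‖ := norm_pos_iff.2 h1
    rw [norm_div, norm_mul, div_le_div_iff₀ h5 hc]
    have h6 : 0 ≤ C * |t - t₀| := (norm_nonneg _).trans h3
    rcases (abs_nonneg (t - t₀)).eq_or_lt with h0 | h0
    · have h7 : ‖F t‖ = 0 := le_antisymm (by simpa [← h0] using h3) (norm_nonneg _)
      have hC : 0 ≤ C * M * ‖w t - κ ε‖ := by
        have hM0 : 0 ≤ M := (norm_nonneg _).trans h4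
        have hlt : α < β := by
          rw [uIoc_of_le hαβ] at ht
          exact ht.1.trans_le ht.2
        have hC0 : 0 ≤ C := by
          by_contra hneg
          push Not at hneg
          have key : ∀ s ∈ Icc α β, s = t₀ := fun s hs => by
            by_contra hne
            have := abs_pos.2 (sub_ne_zero.2 hne)
            have := (norm_nonneg _).trans (hF s hs)
            nlinarith
          exact hlt.ne ((key α ⟨le_rfl, hαβ⟩).trans (key β ⟨hαβ, le_rfl⟩).symm)
        positivity
      rw [h7]; simpa using hC
    · have hC0 : 0 ≤ C := nonneg_of_mul_nonneg_left h6 h0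
      have hM0 : 0 ≤ M := (norm_nonneg _).trans h4
      calc ‖F t‖ * ‖w' t‖ * c ≤ (C * |t - t₀|) * M * c := by gcongr
        _ = C * M * (c * |t - t₀|) := by ring
        _ ≤ C * M * ‖w t - κ ε‖ := by gcongr
  · refine Filter.Eventually.of_forall fun t ht => ?_
    have ht' := hioc ht
    by_cases h : t = t₀
    · have h3 := hF t ht'
      have : F t = 0 := by simpa [h] using h3
      simp [this]
    · have hne : w t ≠ 0 := by
        rw [← norm_pos_iff]
        exact (mul_pos hc (abs_pos.2 (sub_ne_zero.2 h))).trans_le (hw t (hsub ht'))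
      have h0 : Filter.Tendsto (fun ε => w t - κ ε) (𝓝[>] 0) (𝓝 (w t)) := by
        simpa using (tendsto_const_nhds (x := w t)).sub hκ
      exact tendsto_const_nhds.div h0 hne

/-- A normalised `C¹` curve through `0` at time `t₀` is trapped in a cone around the real axis
near `t₀`. -/
lemma exists_norm_sub_le_half {w w' : ℝ → ℂ} {t₀ : ℝ} (ht₀ : t₀ ∈ Ioo (0 : ℝ) 1)
    (hwd : ∀ t ∈ Icc (0 : ℝ) 1, HasDerivWithinAt w (w' t) (Icc 0 1) t)
    (hw'c : ContinuousOn w' (Icc 0 1)) (hw0 : w t₀ = 0) (hw'0 : w' t₀ = 1) :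
    ∃ η > 0, 0 < t₀ - η ∧ t₀ + η < 1 ∧
      ∀ t ∈ Icc (t₀ - η) (t₀ + η), ‖w t - ((t - t₀ : ℝ) : ℂ)‖ ≤ 1 / 2 * |t - t₀| := by
  have hnhds : Icc (0 : ℝ) 1 ∈ 𝓝 t₀ := Icc_mem_nhds ht₀.1 ht₀.2
  have hcont : ContinuousAt w' t₀ := hw'c.continuousAt hnhds
  obtain ⟨d, hd, hball⟩ := Metric.continuousAt_iff.1 hcont (1 / 2) (by norm_num)
  obtain ⟨ht1, ht2⟩ := ht₀
  refine ⟨min (d / 2) (min (t₀ / 2) ((1 - t₀) / 2)), by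
    have : 0 < 1 - t₀ := by linarith
    positivity, ?_, ?_, ?_⟩
  · have := (min_le_right (d / 2) (min (t₀ / 2) ((1 - t₀) / 2))).trans (min_le_left _ _)
    linarith
  · have := (min_le_right (d / 2) (min (t₀ / 2) ((1 - t₀) / 2))).trans (min_le_right _ _)
    linarith
  set η := min (d / 2) (min (t₀ / 2) ((1 - t₀) / 2)) with hη
  have h1 : η ≤ d / 2 := min_le_left _ _
  have h2 : η ≤ t₀ / 2 := (min_le_right _ _).trans (min_le_left _ _)
  have h3 : η ≤ (1 - t₀) / 2 := (min_le_right _ _).trans (min_le_right _ _)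
  have hη0 : 0 ≤ η := by
    have : 0 < 1 - t₀ := by linarith
    positivity
  intro t ht
  have hsub : Icc (t₀ - η) (t₀ + η) ⊆ Icc 0 1 := Icc_subset_Icc (by linarith) (by linarith)
  have hder : ∀ s ∈ Icc (t₀ - η) (t₀ + η), HasDerivWithinAt
      (fun s : ℝ => w s - ((s - t₀ : ℝ) : ℂ)) (w' s - 1) (Icc (t₀ - η) (t₀ + η)) s := by
    intro s hs
    have h := ((hasDerivAt_id s).sub_const t₀).ofReal_comp
    simpa using ((hwd s (hsub hs)).mono hsub).fun_sub h.hasDerivWithinAt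
  have hbd : ∀ s ∈ Icc (t₀ - η) (t₀ + η), ‖w' s - 1‖ ≤ 1 / 2 := by
    intro s hs
    have hdist : dist s t₀ < d := by
      rw [Real.dist_eq, abs_lt]
      constructor <;> linarith [hs.1, hs.2]
    have := hball hdist
    rw [hw'0, dist_eq_norm] at this
    exact this.le
  have := (convex_Icc (t₀ - η) (t₀ + η)).norm_image_sub_le_of_norm_hasDerivWithin_le hder hbd
    (⟨by linarith, by linarith⟩ : t₀ ∈ Icc (t₀ - η) (t₀ + η)) ht
  simpa [hw0] using this

/-- An injective curve vanishing at `t₀`, trapped in a cone near `t₀`, stays away from small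
points of the imaginary axis, linearly in the distance to `t₀`. -/
lemma exists_mul_abs_le_norm_sub {w : ℝ → ℂ} {t₀ η : ℝ} (ht₀ : t₀ ∈ Icc (0 : ℝ) 1) (hη : 0 < η)
    (hwc : ContinuousOn w (Icc 0 1)) (hinj : InjOn w (Icc 0 1)) (hw0 : w t₀ = 0)
    (hcone : ∀ t ∈ Icc (t₀ - η) (t₀ + η), 1 / 2 * |t - t₀| ≤ |(w t).re|) :
    ∃ c > 0, ∃ r > 0, ∀ y : ℝ, |y| < r → ∀ t ∈ Icc (0 : ℝ) 1,
      c * |t - t₀| ≤ ‖w t - y * I‖ := by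
  have hK : IsCompact (Icc (0 : ℝ) 1 \ Ioo (t₀ - η) (t₀ + η)) :=
    isCompact_Icc.diff isOpen_Ioo
  obtain ⟨m, hm, hmK⟩ : ∃ m > 0, ∀ t ∈ Icc (0 : ℝ) 1 \ Ioo (t₀ - η) (t₀ + η), m ≤ ‖w t‖ := by
    refine hK.exists_forall_le' (hwc.mono sdiff_subset).norm fun t ht => ?_
    rw [norm_pos_iff, ← hw0]
    intro h
    have := hinj ht.1 ht₀ h
    exact ht.2 (by rw [this]; constructor <;> linarith)
  refine ⟨min (1 / 2) (m / 2), by positivity, m / 2, by positivity, fun y hy t ht => ?_⟩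
  by_cases h : t ∈ Ioo (t₀ - η) (t₀ + η)
  · calc min (1 / 2) (m / 2) * |t - t₀| ≤ 1 / 2 * |t - t₀| := by gcongr; exact min_le_left _ _
      _ ≤ |(w t).re| := hcone t (Ioo_subset_Icc_self h)
      _ = |(w t - y * I).re| := by simp
      _ ≤ _ := abs_re_le_norm _
  · have h1 := hmK t ⟨ht, h⟩
    have h2 : ‖w t‖ - ‖(y : ℂ) * I‖ ≤ ‖w t - y * I‖ := norm_sub_norm_le _ _
    have h3 : ‖(y : ℂ) * I‖ = |y| := by simp
    have h4 : |t - t₀| ≤ 1 := by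
      rw [abs_le]; constructor <;> linarith [ht.1, ht.2, ht₀.1, ht₀.2]
    calc min (1 / 2) (m / 2) * |t - t₀| ≤ (m / 2) * 1 := by
          gcongr; exact min_le_right _ _
      _ ≤ _ := by linarith

/-- One-sided limit of the logarithmic integral along a curve crossing the imaginary axis
only at `0`. -/
lemma tendsto_integral_deriv_div_sub {w w' : ℝ → ℂ} {t₀ a b σ : ℝ} (hab : a ≤ b)
    (hσ : σ * σ = 1)
    (hwd : ∀ t ∈ Icc a b, HasDerivWithinAt w (w' t) (Icc a b) t)
    (hw'c : ContinuousOn w' (Icc a b)) (hw0 : w t₀ = 0) (hat : a ≠ t₀) (hbt : b ≠ t₀)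
    (hre : ∀ t ∈ Icc a b, t ≠ t₀ → (w t).re ≠ 0) :
    Filter.Tendsto (fun ε : ℝ => ∫ t in a..b, w' t / (w t - (σ * ε : ℝ) * I)) (𝓝[>] 0)
      (𝓝 (log (σ * I * w b) - log (σ * I * w a))) := by
  have hσ0 : σ ≠ 0 := by rintro rfl; simp at hσ
  have hσc : (σ : ℂ) * σ = 1 := by exact_mod_cast hσ
  have him : ∀ t ε : ℝ, (σ * I * w t + ε).im = σ * (w t).re := fun t ε => by simp
  have hslit : ∀ ε > (0 : ℝ), ∀ t ∈ Icc a b, σ * I * w t + ε ∈ slitPlane := by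
    intro ε hε t ht
    by_cases h : t = t₀
    · rw [h, hw0]; simp [hε]
    · exact Or.inr (by rw [him]; exact mul_ne_zero hσ0 (hre t ht h))
  have hwc : ContinuousOn w (Icc a b) := fun t ht => (hwd t ht).continuousWithinAt
  have hfact : ∀ (ε : ℝ) (t : ℝ), σ * I * w t + ε = σ * I * (w t - (σ * ε : ℝ) * I) := by
    intro ε t
    push_cast
    linear_combination (-(ε : ℂ)) * hσc + (σ * σ * ε : ℂ) * I_sq
  have hint : ∀ ε > (0 : ℝ), ∫ t in a..b, w' t / (w t - (σ * ε : ℝ) * I) =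
      log (σ * I * w b + ε) - log (σ * I * w a + ε) := by
    intro ε hε
    have hd : ∀ t ∈ Icc a b, HasDerivWithinAt (fun t => log (σ * I * w t + ε))
        (w' t / (w t - (σ * ε : ℝ) * I)) (Icc a b) t := by
      intro t ht
      have h := (((hwd t ht).const_mul (σ * I : ℂ)).add_const (ε : ℂ)).clog_real
        (hslit ε hε t ht)
      convert h using 1
      rw [hfact, mul_div_mul_left]
      exact mul_ne_zero (by exact_mod_cast hσ0) I_ne_zero
    have hne : ∀ t ∈ Icc a b, w t - (σ * ε : ℝ) * I ≠ 0 := by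
      intro t ht h0
      have := slitPlane_ne_zero (hslit ε hε t ht)
      rw [hfact, h0, mul_zero] at this
      exact this rfl
    refine intervalIntegral.integral_eq_sub_of_hasDerivAt_of_le hab
      (fun t ht => (hd t ht).continuousWithinAt)
      (fun t ht => (hd t (Ioo_subset_Icc_self ht)).hasDerivAt (Icc_mem_nhds ht.1 ht.2)) ?_
    refine ContinuousOn.intervalIntegrable ?_
    rw [uIcc_of_le hab]
    exact hw'c.div (hwc.sub continuousOn_const) hne
  have hlim : ∀ t ∈ Icc a b, t ≠ t₀ → Filter.Tendsto (fun ε : ℝ => log (σ * I * w t + ε))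
      (𝓝[>] 0) (𝓝 (log (σ * I * w t))) := by
    intro t ht h
    have h1 : σ * I * w t ∈ slitPlane :=
      Or.inr (by simpa using ⟨hσ0, hre t ht h⟩)
    refine Filter.Tendsto.clog ?_ h1
    have : Continuous fun ε : ℝ => σ * I * w t + (ε : ℂ) := by fun_prop
    simpa using (this.tendsto 0).mono_left nhdsWithin_le_nhds
  refine ((hlim b ⟨hab, le_rfl⟩ hbt).sub (hlim a ⟨le_rfl, hab⟩ hat)).congr' ?_
  filter_upwards [self_mem_nhdsWithin] with ε hε
  exact (hint ε hε).symm

lemma log_sub_log_neg_of_im_pos {z : ℂ} (hz : 0 < z.im) : log z - log (-z) = Real.pi * I := by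
  apply Complex.ext
  · simp [log_re]
  · simp [log_im, arg_neg_eq_arg_sub_pi_of_im_pos hz]

/-- Sokhotski–Plemelj jump formula for a normalised curve. -/
lemma exists_tendsto_cauchy_integral_normalized {w w' φ : ℝ → ℂ} {t₀ : ℝ}
    (ht₀ : t₀ ∈ Ioo (0 : ℝ) 1)
    (hwd : ∀ t ∈ Icc (0 : ℝ) 1, HasDerivWithinAt w (w' t) (Icc 0 1) t)
    (hw'c : ContinuousOn w' (Icc 0 1)) (hinj : InjOn w (Icc 0 1))
    (hw0 : w t₀ = 0) (hw'0 : w' t₀ = 1) (hφ : ContDiffOn ℝ 1 φ (Icc 0 1)) :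
    ∃ A : ℝ → ℂ, (∀ σ : ℝ, σ * σ = 1 → Filter.Tendsto
        (fun ε : ℝ => ∫ t in (0 : ℝ)..1, φ t * w' t / (w t - (σ * ε : ℝ) * I))
        (𝓝[>] 0) (𝓝 (A σ))) ∧ A 1 - A (-1) = 2 * Real.pi * I * φ t₀ := by
  obtain ⟨η, hη, hη0, hη1, hcone⟩ := exists_norm_sub_le_half ht₀ hwd hw'c hw0 hw'0
  have hwc : ContinuousOn w (Icc 0 1) := fun t ht => (hwd t ht).continuousWithinAt
  have hφc : ContinuousOn φ (Icc 0 1) := hφ.continuousOn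
  have ht₀' : t₀ ∈ Icc (0 : ℝ) 1 := Ioo_subset_Icc_self ht₀
  have hre : ∀ t ∈ Icc (t₀ - η) (t₀ + η), |(w t).re - (t - t₀)| ≤ 1 / 2 * |t - t₀| := by
    intro t ht
    have h := (abs_re_le_norm _).trans (hcone t ht)
    rwa [sub_re, ofReal_re] at h
  have hre' : ∀ t ∈ Icc (t₀ - η) (t₀ + η), 1 / 2 * |t - t₀| ≤ |(w t).re| := by
    intro t ht
    have h1 := abs_sub_abs_le_abs_sub (t - t₀) (w t).re
    rw [abs_sub_comm (t - t₀)] at h1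
    linarith [hre t ht]
  have hbre : 0 < (w (t₀ + η)).re := by
    have := (abs_le.1 (hre (t₀ + η) ⟨by linarith, le_rfl⟩)).1
    rw [add_sub_cancel_left, abs_of_pos hη] at this
    linarith
  have hare : (w (t₀ - η)).re < 0 := by
    have := (abs_le.1 (hre (t₀ - η) ⟨le_rfl, by linarith⟩)).2
    rw [sub_sub_cancel_left, abs_neg, abs_of_pos hη] at this
    linarith
  obtain ⟨c, hc, r, hr, hlow⟩ := exists_mul_abs_le_norm_sub ht₀' hη hwc hinj hw0 hre'
  obtain ⟨K, hK⟩ := hφ.exists_lipschitzOnWith one_ne_zero (convex_Icc 0 1) isCompact_Icc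
  obtain ⟨M, hM⟩ := isCompact_Icc.exists_bound_of_continuousOn hφc
  have hM0 : 0 ≤ M := (norm_nonneg _).trans (hM t₀ ht₀')
  have hfar : ∀ t ∈ Icc (0 : ℝ) 1, η ≤ |t - t₀| → ‖φ t‖ ≤ M / η * |t - t₀| := by
    intro t ht h
    calc ‖φ t‖ ≤ M := hM t ht
      _ = M / η * η := by field_simp
      _ ≤ _ := by gcongr
  set a := t₀ - η with ha
  set b := t₀ + η with hb
  have hab : a ≤ b := by linarith
  have hsub : Icc a b ⊆ Icc 0 1 := Icc_subset_Icc hη0.le hη1.le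
  have hw00 : ∀ t ∈ Icc (0 : ℝ) 1, c * |t - t₀| ≤ ‖w t‖ := by
    intro t ht
    simpa using hlow 0 (by simpa using hr) t ht
  refine ⟨fun σ => (∫ t in 0..a, φ t * w' t / w t) +
    ((∫ t in a..b, (φ t - φ t₀) * w' t / w t) +
      φ t₀ * (log (σ * I * w b) - log (σ * I * w a))) +
    (∫ t in b..1, φ t * w' t / w t), ?_, ?_⟩
  · intro σ hσ
    have hσ0 : σ ≠ 0 := by rintro rfl; simp at hσ
    have hσabs : |σ| = 1 := by
      rw [← abs_one, ← abs_one, abs_eq_abs]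
      simpa using mul_self_eq_one_iff.1 hσ
    have hκ : Filter.Tendsto (fun ε : ℝ => ((σ * ε : ℝ) : ℂ) * I) (𝓝[>] 0) (𝓝 0) := by
      have : Continuous fun ε : ℝ => ((σ * ε : ℝ) : ℂ) * I := by fun_prop
      simpa using (this.tendsto 0).mono_left nhdsWithin_le_nhds
    have hwκ : ∀ᶠ ε in 𝓝[>] (0 : ℝ), ∀ t ∈ Icc (0 : ℝ) 1,
        w t - (σ * ε : ℝ) * I ≠ 0 ∧ c * |t - t₀| ≤ ‖w t - (σ * ε : ℝ) * I‖ := by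
      filter_upwards [Ioo_mem_nhdsGT hr] with ε hε t ht
      have h1 := hlow (σ * ε) (by rw [abs_mul, hσabs, one_mul, abs_of_pos hε.1]; exact hε.2) t ht
      refine ⟨?_, h1⟩
      by_cases h : t = t₀
      · rw [h, hw0]
        simpa using ⟨hσ0, hε.1.ne'⟩
      · rw [← norm_pos_iff]
        exact (mul_pos hc (abs_pos.2 (sub_ne_zero.2 h))).trans_le h1
    have hleft := tendsto_cauchy_integral_of_density_le (C := M / η) le_rfl hη0.le
      (by linarith) hc hwc hw'c hφc
      (fun t ht => hfar t ⟨ht.1, by linarith [ht.2]⟩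
        (by rw [abs_sub_comm]; exact le_trans (by linarith [ht.2]) (le_abs_self _)))
      hw00 hκ hwκ
    have hright := tendsto_cauchy_integral_of_density_le (C := M / η) (by linarith) hη1.le
      le_rfl hc hwc hw'c hφc
      (fun t ht => hfar t ⟨by linarith [ht.1], ht.2⟩
        (le_trans (by linarith [ht.1]) (le_abs_self _)))
      hw00 hκ hwκ
    have hmid := tendsto_cauchy_integral_of_density_le (F := fun t => φ t - φ t₀) (C := K)
      hη0.le hab hη1.le hc hwc hw'c (hφc.sub continuousOn_const)
      (fun t ht => by simpa [dist_eq_norm] using hK.dist_le_mul t (hsub ht) t₀ ht₀')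
      hw00 hκ hwκ
    have hlog := tendsto_integral_deriv_div_sub (t₀ := t₀) hab hσ
      (fun t ht => (hwd t (hsub ht)).mono hsub) (hw'c.mono hsub) hw0 (by linarith) (by linarith)
      (fun t ht h => abs_pos.1 (lt_of_lt_of_le
        (mul_pos (by norm_num) (abs_pos.2 (sub_ne_zero.2 h))) (hre' t ht)))
    refine ((hleft.add (hmid.add (hlog.const_mul (φ t₀)))).add hright).congr' ?_
    filter_upwards [hwκ] with ε hε
    have hci : ∀ F : ℝ → ℂ, ContinuousOn F (Icc 0 1) → ∀ x ∈ Icc (0 : ℝ) 1, ∀ y ∈ Icc (0 : ℝ) 1,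
        IntervalIntegrable (fun t => F t * w' t / (w t - (σ * ε : ℝ) * I))
          MeasureTheory.volume x y := by
      intro F hF x hx y hy
      refine ContinuousOn.intervalIntegrable (ContinuousOn.mono ?_ (uIcc_subset_Icc hx hy))
      exact (hF.mul hw'c).div (hwc.sub continuousOn_const) fun t ht => (hε t ht).1
    have h0 : (0 : ℝ) ∈ Icc (0 : ℝ) 1 := by simp
    have h1 : (1 : ℝ) ∈ Icc (0 : ℝ) 1 := by simp
    have ha' : a ∈ Icc (0 : ℝ) 1 := hsub ⟨le_rfl, hab⟩
    have hb' : b ∈ Icc (0 : ℝ) 1 := hsub ⟨hab, le_rfl⟩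
    rw [← intervalIntegral.integral_add_adjacent_intervals (hci φ hφc 0 h0 b hb')
        (hci φ hφc b hb' 1 h1),
      ← intervalIntegral.integral_add_adjacent_intervals (hci φ hφc 0 h0 a ha')
        (hci φ hφc a ha' b hb'),
      ← intervalIntegral.integral_const_mul, ← intervalIntegral.integral_add
        (hci (fun t => φ t - φ t₀) (hφc.sub continuousOn_const) a ha' b hb')
        (by simpa only [mul_div_assoc] using
          hci (fun _ => φ t₀) continuousOn_const a ha' b hb')]
    congr 3
    funext t
    ring
  · have h1 := log_sub_log_neg_of_im_pos (z := I * w b) (by simpa using hbre)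
    have h2 := log_sub_log_neg_of_im_pos (z := -(I * w a)) (by simpa using hare)
    rw [neg_neg] at h2
    simp only [ofReal_one, ofReal_neg, one_mul, neg_mul]
    linear_combination φ t₀ * (h1 + h2)

/-- A Cauchy integral over a curve in the closed lower half-plane is continuous in the open
upper half-plane. -/
lemma continuousAt_cauchy_integral_of_im_nonpos {u g : ℝ → ℂ} {p : ℂ}
    (huc : ContinuousOn u (Icc 0 1)) (hgc : ContinuousOn g (Icc 0 1))
    (hu : ∀ t ∈ Icc (0 : ℝ) 1, (u t).im ≤ 0) (hp : 0 < p.im) :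
    ContinuousAt (fun k : ℂ => ∫ t in (0 : ℝ)..1, g t / (u t - k)) p := by
  obtain ⟨M, hM⟩ := isCompact_Icc.exists_bound_of_continuousOn hgc
  have hioc : Ι (0 : ℝ) 1 ⊆ Icc 0 1 := by
    rw [uIoc_of_le zero_le_one]; exact Ioc_subset_Icc_self
  have hlow : ∀ k : ℂ, ∀ t ∈ Icc (0 : ℝ) 1, k.im ≤ ‖u t - k‖ := by
    intro k t ht
    refine le_trans ?_ (abs_im_le_norm _)
    rw [sub_im, abs_sub_comm]
    exact le_trans (by linarith [hu t ht]) (le_abs_self _)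
  have hne : ∀ k : ℂ, 0 < k.im → ∀ t ∈ Icc (0 : ℝ) 1, u t - k ≠ 0 := fun k hk t ht =>
    norm_pos_iff.1 (hk.trans_le (hlow k t ht))
  have hnear : ∀ᶠ k in 𝓝 p, p.im / 2 < k.im :=
    continuous_im.continuousAt.eventually (lt_mem_nhds (by linarith))
  refine intervalIntegral.continuousAt_of_dominated_interval (bound := fun _ => M / (p.im / 2))
    ?_ ?_ (by simp) ?_
  · filter_upwards [hnear] with k hk
    exact ((hgc.div (huc.sub continuousOn_const) (hne k (by linarith))).mono
      hioc).aestronglyMeasurable measurableSet_uIoc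
  · filter_upwards [hnear] with k hk
    refine Filter.Eventually.of_forall fun t ht => ?_
    have h0 := hM t (hioc ht)
    have h1 := hlow k t (hioc ht)
    have hM0 : 0 ≤ M := (norm_nonneg _).trans h0
    rw [norm_div]
    gcongr
    linarith
  · refine Filter.Eventually.of_forall fun t ht => ?_
    exact continuousAt_const.div (continuousAt_const.sub continuousAt_id) (hne p hp t (hioc ht))

/-- Jump relation of `δ̃` across the interior of the curve `Γ`:
`δ̃₊(γ(t₀)) = δ̃₋(γ(t₀)) · e^{−φ(t₀)}`, both boundary values existing and nonzero. -/
theorem stmt16 (μ : ℝ) (γ γ' φ : ℝ → ℂ)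
    (hγ0 : γ 0 = (μ : ℂ))
    (hγd : ∀ t ∈ Set.Icc (0:ℝ) 1, HasDerivWithinAt γ (γ' t) (Set.Icc 0 1) t)
    (hγ'c : ContinuousOn γ' (Set.Icc 0 1))
    (hγ'ne : ∀ t ∈ Set.Icc (0:ℝ) 1, γ' t ≠ 0)
    (hγinj : Set.InjOn γ (Set.Icc 0 1))
    (hγim : ∀ t ∈ Set.Ioc (0:ℝ) 1, 0 < (γ t).im)
    (hφ : ContDiffOn ℝ 1 φ (Set.Icc 0 1))
    (hφ0 : (φ 0).im = 0)
    (Γ : Set ℂ) (hΓ : Γ = γ '' Set.Icc 0 1)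
    (δ : ℂ → ℂ)
    (hδ : ∀ k : ℂ, δ k = Complex.exp (
      -(1 / (2 * Real.pi * Complex.I)) *
          (∫ t in (0:ℝ)..1, φ t * γ' t / (γ t - k)) +
        (1 / (2 * Real.pi * Complex.I)) *
          (∫ t in (0:ℝ)..1, conj (φ t) * conj (γ' t) / (conj (γ t) - k)))) :
    ∀ t₀ ∈ Set.Ioo (0:ℝ) 1,
      ∃ δp δm : ℂ,
        Filter.Tendsto (fun ε : ℝ => δ (γ t₀ + (ε : ℂ) * Complex.I * γ' t₀))
          (𝓝[>] 0) (𝓝 δp) ∧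
        Filter.Tendsto (fun ε : ℝ => δ (γ t₀ - (ε : ℂ) * Complex.I * γ' t₀))
          (𝓝[>] 0) (𝓝 δm) ∧
        δp ≠ 0 ∧ δm ≠ 0 ∧
        δp = δm * Complex.exp (-φ t₀) := by
  intro t₀ ht₀
  have ht₀' : t₀ ∈ Icc (0 : ℝ) 1 := Ioo_subset_Icc_self ht₀
  have hne := hγ'ne t₀ ht₀'
  obtain ⟨A, hA, hjump⟩ := exists_tendsto_cauchy_integral_normalized
    (w := fun t => (γ t - γ t₀) / γ' t₀) (w' := fun t => γ' t / γ' t₀) (φ := φ) ht₀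
    (fun t ht => ((hγd t ht).sub_const _).div_const _) (hγ'c.div_const _)
    (fun s hs t ht h => hγinj hs ht (by simpa [div_left_inj' hne] using h))
    (by simp) (div_self hne) hφ
  have hγc : ContinuousOn γ (Icc 0 1) := fun t ht => (hγd t ht).continuousWithinAt
  have hconj := continuousAt_cauchy_integral_of_im_nonpos (p := γ t₀)
    (continuous_conj.comp_continuousOn hγc)
    ((continuous_conj.comp_continuousOn hφ.continuousOn).mul
      (continuous_conj.comp_continuousOn hγ'c))
    (fun t ht => by
      rcases ht.1.eq_or_lt with h | h
      · simp [← h, hγ0]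
      · simpa using (hγim t ⟨h, ht.2⟩).le)
    (hγim t₀ ⟨ht₀.1, ht₀.2.le⟩)
  set B := ∫ t in (0:ℝ)..1, conj (φ t) * conj (γ' t) / (conj (γ t) - γ t₀) with hB
  have hlim : ∀ σ : ℝ, σ * σ = 1 → Filter.Tendsto
      (fun ε : ℝ => δ (γ t₀ + (σ * ε : ℝ) * I * γ' t₀)) (𝓝[>] 0)
      (𝓝 (exp (-(1 / (2 * Real.pi * I)) * A σ + (1 / (2 * Real.pi * I)) * B))) := by
    intro σ hσ
    simp only [hδ]
    have hk : Filter.Tendsto (fun ε : ℝ => γ t₀ + (σ * ε : ℝ) * I * γ' t₀) (𝓝[>] 0)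
        (𝓝 (γ t₀)) := by
      have : Continuous fun ε : ℝ => γ t₀ + (σ * ε : ℝ) * I * γ' t₀ := by fun_prop
      simpa using (this.tendsto 0).mono_left nhdsWithin_le_nhds
    refine ((Filter.Tendsto.const_mul _ ?_).add ((hconj.tendsto.comp hk).const_mul _)).cexp
    refine (hA σ hσ).congr fun ε => ?_
    congr 1
    funext t
    have h : (γ t - γ t₀) / γ' t₀ - (σ * ε : ℝ) * I =
        (γ t - (γ t₀ + (σ * ε : ℝ) * I * γ' t₀)) / γ' t₀ := by
      field_simp
      ring
    rw [h, ← mul_div_assoc, div_div_div_cancel_right₀ hne]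
  refine ⟨_, _, (hlim 1 (by norm_num)).congr fun ε => ?_,
    (hlim (-1) (by norm_num)).congr fun ε => ?_, exp_ne_zero _, exp_ne_zero _, ?_⟩
  · simp
  · congr 1
    push_cast
    ring
  · rw [← exp_add]
    congr 1
    have hπ : (2 * Real.pi * I : ℂ) ≠ 0 := two_pi_I_ne_zero
    have hA1 : A 1 = A (-1) + 2 * Real.pi * I * φ t₀ := by linear_combination hjump
    rw [hA1]
    field_simp
    ring
end
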